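/- For every field K of characteristic ≠ 2 and every polynomial D ∈ S_K with deg D = 2d, there exist infinitely many pairwise non-equivalent elements α ∈ K(T, √D) \ K(T) (i.e. quadratic irrationalities of the form (A + B√D)/C with A, B, C ∈ K[T], B, C ≠ 0) such that K(α) ≤ d. -/

import Mathlib

noncomputable section

namespace PaperCF

variable {K : Type*} [Field K]

/-- The element `T` of `K((T⁻¹))`, where `K((T⁻¹))` is modeled as the field
`LaurentSeries K` of Laurent series in the variable `t = T⁻¹`. -/
def Tvar (K : Type*) [Field K] : LaurentSeries K := (HahnSeries.single (-1 : ℤ) (1 : K))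

/-- The embedding of `K[T]` into `K((T⁻¹))`, sending the polynomial variable to `T = t⁻¹`. -/
def emb : Polynomial K →+* LaurentSeries K := (Polynomial.aeval (Tvar K)).toRingHom

/-- The polynomial part `⌊α⌋` of a formal Laurent series `α ∈ K((T⁻¹))`. -/
def polyPart (α : LaurentSeries K) : Polynomial K :=
  ∑ i ∈ Finset.range ((-α.order).toNat + 1), Polynomial.monomial i (α.coeff (-(i : ℤ)))

/-- The complete quotients `αₙ` of the regular continued fraction expansion of `α`
(with the convention `0⁻¹ = 0`, so that `cq α n = 0` for all `n` past the end of a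
finite expansion). -/
def cq (α : LaurentSeries K) : ℕ → LaurentSeries K
  | 0 => α
  | n + 1 => (cq α n - emb (polyPart (cq α n)))⁻¹

/-- The partial quotients `aₙ = ⌊αₙ⌋` of the regular continued fraction expansion of `α`. -/
def pq (α : LaurentSeries K) (n : ℕ) : Polynomial K := polyPart (cq α n)

/-- The continuants `(pₙ, qₙ)` of the regular continued fraction expansion of `α`. -/
def cont (α : LaurentSeries K) : ℕ → Polynomial K × Polynomial K
  | 0 => (pq α 0, 1)
  | 1 => (pq α 1 * pq α 0 + 1, pq α 1)
  | n + 2 => (pq α (n + 2) * (cont α (n + 1)).1 + (cont α n).1,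
              pq α (n + 2) * (cont α (n + 1)).2 + (cont α n).2)

/-- `pₙ`. -/
def contP (α : LaurentSeries K) (n : ℕ) : Polynomial K := (cont α n).1

/-- `qₙ`. -/
def contQ (α : LaurentSeries K) (n : ℕ) : Polynomial K := (cont α n).2

/-- The `n`-th partial quotient (and hence the `n`-th convergent) of `α` genuinely exists. -/
def ConvAt (α : LaurentSeries K) (n : ℕ) : Prop := n = 0 ∨ cq α n ≠ 0

/-- `K(α) = sup_{n ≥ 1} deg aₙ`, as an extended natural number. -/
def KK (α : LaurentSeries K) : ℕ∞ :=
  ⨆ n : {n : ℕ // 1 ≤ n ∧ cq α n ≠ 0}, ((pq α n.1).natDegree : ℕ∞)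

/-- `ōK(α) = limsup_n deg aₙ`. -/
def KKbar (α : LaurentSeries K) : ℕ∞ :=
  Filter.limsup (fun n => ((pq α n).natDegree : ℕ∞)) Filter.atTop

/-- `α` is a rational function, i.e. an element of `K(T) ⊆ K((T⁻¹))`. -/
def IsRat (α : LaurentSeries K) : Prop :=
  ∃ p q : Polynomial K, q ≠ 0 ∧ α * emb q = emb p

/-- Two Laurent series are equivalent if they differ by a Möbius transformation with
matrix in `GL₂(K[T])`. -/
def MEquiv (α β : LaurentSeries K) : Prop :=
  ∃ a b c d : Polynomial K, IsUnit (a * d - b * c) ∧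
    emb c * α + emb d ≠ 0 ∧ β = (emb a * α + emb b) / (emb c * α + emb d)

end PaperCF

namespace PaperCF

open Polynomial

variable {K : Type*} [Field K]

theorem emb_monomial (n : ℕ) (a : K) :
    emb (monomial n a) = (HahnSeries.single (-(n : ℤ)) a : LaurentSeries K) := by
  simp [emb, Tvar, aeval_monomial, HahnSeries.single_pow]
  have h : algebraMap K (LaurentSeries K) a = HahnSeries.C a := by
    simp [HahnSeries.algebraMap_apply']
  rw [h, HahnSeries.C_apply, HahnSeries.single_mul_single]
  simp

theorem coeff_emb (p : K[X]) (k : ℤ) :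
    (emb p).coeff k = if k ≤ 0 then p.coeff (-k).toNat else 0 := by
  induction p using Polynomial.induction_on' with
  | add p q hp hq => 
    rw [map_add, HahnSeries.coeff_add, hp, hq]
    split_ifs <;> simp
  | monomial n a =>
    rw [emb_monomial, HahnSeries.coeff_single, coeff_monomial]
    by_cases h : k = -(n : ℤ)
    · subst h; simp
    · rw [if_neg h]
      split_ifs <;> first | rfl | omega

theorem emb_injective : Function.Injective (emb (K := K)) := by
  intro p q h
  ext n
  have := congrArg (fun x : LaurentSeries K => x.coeff (-(n : ℤ))) h
  simpa [coeff_emb] using this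

theorem emb_ne_zero {p : K[X]} (hp : p ≠ 0) : emb p ≠ 0 := by
  rw [← map_zero (emb (K := K))]
  exact fun h => hp (emb_injective h)

theorem order_emb {p : K[X]} (hp : p ≠ 0) : (emb p).order = -(p.natDegree : ℤ) := by
  apply le_antisymm
  · apply HahnSeries.order_le_of_coeff_ne_zero
    simpa [coeff_emb] using hp
  · rw [HahnSeries.le_order_iff_forall (emb_ne_zero hp)]
    intro j hj
    rw [coeff_emb]
    split_ifs
    · exact coeff_eq_zero_of_natDegree_lt (by omega)
    · rfl

theorem coeff_polyPart (x : LaurentSeries K) (n : ℕ) :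
    (polyPart x).coeff n = x.coeff (-(n : ℤ)) := by
  simp only [polyPart, finsetSum_coeff, coeff_monomial]
  rw [Finset.sum_ite_eq']
  split_ifs with h
  · rfl
  · symm
    apply HahnSeries.coeff_eq_zero_of_lt_order
    simp at h
    omega

theorem natDegree_polyPart_le (x : LaurentSeries K) :
    (polyPart x).natDegree ≤ (-x.order).toNat := by
  refine natDegree_le_iff_coeff_eq_zero.2 fun n hn => ?_
  rw [coeff_polyPart]
  exact HahnSeries.coeff_eq_zero_of_lt_order (by omega)

theorem coeff_sub_polyPart (x : LaurentSeries K) {k : ℤ} (hk : k ≤ 0) :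
    (x - emb (polyPart x)).coeff k = 0 := by
  rw [HahnSeries.coeff_sub, coeff_emb, if_pos hk, coeff_polyPart]
  rw [Int.toNat_of_nonneg (by omega)]; simp

theorem order_sub_polyPart_pos {x : LaurentSeries K} (hx : x - emb (polyPart x) ≠ 0) :
    0 < (x - emb (polyPart x)).order := by
  by_contra! h
  exact HahnSeries.coeff_order_eq_zero.not.2 hx (coeff_sub_polyPart x h)

theorem min_order_le_order_sub {x y : LaurentSeries K} (h : x - y ≠ 0) :
    min x.order y.order ≤ (x - y).order := by
  rw [sub_eq_add_neg] at h ⊢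
  simpa [HahnSeries.order_neg] using HahnSeries.min_order_le_order_add h

/-- `x` and its conjugate `y` are at distance at least `1`, and the norm form
`(p - q x) (p - q y)` has absolute value at least `μ ^ (-d) * |x - y|` on nonzero pairs. -/
def WellSeparated (d : ℕ) (x y : LaurentSeries K) : Prop :=
  x - y ≠ 0 ∧ (x - y).order ≤ 0 ∧ ∀ p q : K[X], (p ≠ 0 ∨ q ≠ 0) →
    (emb p - emb q * x) * (emb p - emb q * y) ≠ 0 ∧
      ((emb p - emb q * x) * (emb p - emb q * y)).order ≤ d + (x - y).order

theorem WellSeparated.bounds {d : ℕ} {x y : LaurentSeries K} (h : WellSeparated d x y) :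
    x - emb (polyPart x) ≠ 0 ∧ y - emb (polyPart x) ≠ 0 ∧
      (x - y).order ≤ (y - emb (polyPart x)).order ∧ (x - emb (polyPart x)).order ≤ d := by
  obtain ⟨hxy, h0, hN⟩ := h
  obtain ⟨hne, hord⟩ := hN (polyPart x) 1 (Or.inr one_ne_zero)
  simp only [map_one, one_mul] at hne hord
  have hx : x - emb (polyPart x) ≠ 0 := by
    have := left_ne_zero_of_mul hne
    rwa [← neg_ne_zero, neg_sub] at this
  have hy : y - emb (polyPart x) ≠ 0 := by
    have := right_ne_zero_of_mul hne
    rwa [← neg_ne_zero, neg_sub] at this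
  have hpos := order_sub_polyPart_pos hx
  have hmul : (emb (polyPart x) - x) * (emb (polyPart x) - y) =
      (x - emb (polyPart x)) * (y - emb (polyPart x)) := by ring
  rw [hmul, HahnSeries.order_mul hx hy] at hord
  have hsub : (x - emb (polyPart x)) - (x - y) = y - emb (polyPart x) := by ring
  have hmin := min_order_le_order_sub (x := x - emb (polyPart x)) (y := x - y) (by rwa [hsub])
  rw [hsub] at hmin
  refine ⟨hx, hy, by omega, by omega⟩

theorem WellSeparated.next {d : ℕ} {x y : LaurentSeries K} (h : WellSeparated d x y) :
    WellSeparated d (x - emb (polyPart x))⁻¹ (y - emb (polyPart x))⁻¹ := by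
  obtain ⟨hx, hy, hord, -⟩ := h.bounds
  obtain ⟨hxy, h0, hN⟩ := h
  have hpos := order_sub_polyPart_pos hx
  set a := polyPart x
  have hdiff : ((x - emb a)⁻¹ - (y - emb a)⁻¹) * ((x - emb a) * (y - emb a)) = -(x - y) := by
    field_simp
    ring
  have hprod : (x - emb a) * (y - emb a) ≠ 0 := mul_ne_zero hx hy
  have hne : (x - emb a)⁻¹ - (y - emb a)⁻¹ ≠ 0 := by
    intro h
    rw [h, zero_mul] at hdiff
    exact hxy (neg_eq_zero.1 hdiff.symm)
  have hdord := congrArg HahnSeries.order hdiff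
  rw [HahnSeries.order_mul hne hprod, HahnSeries.order_mul hx hy, HahnSeries.order_neg] at hdord
  refine ⟨hne, by omega, fun p q hpq => ?_⟩
  obtain ⟨hne', hord'⟩ := hN (q + p * a) p (by
    by_cases hp : p = 0
    · left; simpa [hp] using hpq
    · exact Or.inr hp)
  have hform : (emb p - emb q * (x - emb a)⁻¹) * (emb p - emb q * (y - emb a)⁻¹) *
      ((x - emb a) * (y - emb a)) =
      (emb (q + p * a) - emb p * x) * (emb (q + p * a) - emb p * y) := by
    rw [map_add, map_mul]
    field_simp
    ring
  have hne2 : (emb p - emb q * (x - emb a)⁻¹) * (emb p - emb q * (y - emb a)⁻¹) ≠ 0 := by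
    intro h
    rw [h, zero_mul] at hform
    exact hne' hform.symm
  refine ⟨hne2, ?_⟩
  rw [← hform, HahnSeries.order_mul hne2 hprod, HahnSeries.order_mul hx hy] at hord'
  omega

theorem WellSeparated.exists_cq {d : ℕ} {x y : LaurentSeries K} (h : WellSeparated d x y) (n : ℕ) :
    ∃ z, WellSeparated d (cq x n) z := by
  induction n with
  | zero => exact ⟨y, h⟩
  | succ n ih =>
    obtain ⟨z, hz⟩ := ih
    exact ⟨_, hz.next⟩

theorem order_inv {x : LaurentSeries K} (hx : x ≠ 0) : x⁻¹.order = -x.order := by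
  have := HahnSeries.order_mul hx (inv_ne_zero hx)
  rw [mul_inv_cancel₀ hx, HahnSeries.order_one] at this
  omega

theorem WellSeparated.KK_le {d : ℕ} {x y : LaurentSeries K} (h : WellSeparated d x y) :
    KK x ≤ d := by
  refine iSup_le fun n => ?_
  obtain ⟨n, hn, -⟩ := n
  obtain ⟨n, rfl⟩ : ∃ m, n = m + 1 := ⟨n - 1, by omega⟩
  obtain ⟨z, hz⟩ := h.exists_cq n
  obtain ⟨hx, -, -, hord⟩ := hz.bounds
  have := natDegree_polyPart_le (cq x (n + 1))
  rw [show cq x (n + 1) = (cq x n - emb (polyPart (cq x n)))⁻¹ from rfl, order_inv hx] at this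
  refine Nat.cast_le.2 ?_
  change (polyPart (cq x n - emb (polyPart (cq x n)))⁻¹).natDegree ≤ d
  omega

theorem MEquiv.symm {x y : LaurentSeries K} (h : MEquiv x y) : MEquiv y x := by
  obtain ⟨a, b, c, d, hu, hne, rfl⟩ := h
  have hdet : emb a * emb d - emb b * emb c ≠ 0 := by
    rw [← map_mul, ← map_mul, ← map_sub]
    exact emb_ne_zero hu.ne_zero
  have hne' : x * emb c + emb d ≠ 0 := by rwa [mul_comm x]
  have hden : emb (-c) * ((emb a * x + emb b) / (emb c * x + emb d)) + emb a =
      (emb a * emb d - emb b * emb c) / (emb c * x + emb d) := by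
    rw [map_neg]
    field_simp
    ring
  refine ⟨d, -b, -c, a, by convert hu using 1; ring, ?_, ?_⟩
  · rw [hden]
    exact div_ne_zero hdet hne
  · rw [hden, map_neg, eq_div_iff (div_ne_zero hdet hne)]
    field_simp
    ring

/-- Discriminants of integral quadratic equations satisfied by equivalent irrational series agree
up to squares of polynomials, once `κ` lies in the content ideal of the first equation. -/
theorem MEquiv.discrim {x y : LaurentSeries K} (h : MEquiv x y)
    (hirr : ∀ a b : K[X], emb a * x + emb b = 0 → a = 0 ∧ b = 0)
    {A B C A' B' C' κ r s t : K[X]} (hA : A ≠ 0)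
    (hF : emb A * x ^ 2 + emb B * x + emb C = 0)
    (hG : emb A' * y ^ 2 + emb B' * y + emb C' = 0)
    (hκ : κ = r * A + s * B + t * C) :
    ∃ R e : K[X], IsUnit e ∧
      κ ^ 2 * e ^ 2 * (B' ^ 2 - 4 * A' * C') = R ^ 2 * (B ^ 2 - 4 * A * C) := by
  obtain ⟨a, b, c, d, hu, hne, rfl⟩ := h
  set A₁ := A' * a ^ 2 + B' * a * c + C' * c ^ 2 with hA₁
  set B₁ := 2 * A' * a * b + B' * (a * d + b * c) + 2 * C' * c * d with hB₁
  set C₁ := A' * b ^ 2 + B' * b * d + C' * d ^ 2 with hC₁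
  have hH : emb A₁ * x ^ 2 + emb B₁ * x + emb C₁ = 0 := by
    have hne' : x * emb c + emb d ≠ 0 := by rwa [mul_comm x]
    field_simp at hG
    simp only [hA₁, hB₁, hC₁, map_add, map_mul, map_pow, map_ofNat]
    linear_combination hG
  obtain ⟨h1, h2⟩ := hirr (A₁ * B - A * B₁) (A₁ * C - A * C₁) (by
    simp only [map_sub, map_mul]
    linear_combination emb A₁ * hF - emb A * hH)
  have h3 : B₁ * C = B * C₁ := by
    apply mul_left_cancel₀ hA
    linear_combination (-C) * h1 + B * h2
  set R := r * A₁ + s * B₁ + t * C₁ with hR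
  have hκA : κ * A₁ = A * R := by rw [hκ, hR]; linear_combination s * h1 + t * h2
  have hκB : κ * B₁ = B * R := by rw [hκ, hR]; linear_combination (-r) * h1 + t * h3
  have hκC : κ * C₁ = C * R := by rw [hκ, hR]; linear_combination (-r) * h2 - s * h3
  refine ⟨R, a * d - b * c, hu, ?_⟩
  have hdisc : (a * d - b * c) ^ 2 * (B' ^ 2 - 4 * A' * C') = B₁ ^ 2 - 4 * A₁ * C₁ := by
    simp only [hA₁, hB₁, hC₁]; ring
  rw [mul_assoc, hdisc]
  linear_combination (κ * B₁ + B * R) * hκB - 4 * κ * C₁ * hκA - 4 * A * R * hκC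

theorem norm_ne_zero {D p q : K[X]} (hD : ¬ IsSquare D) (hpq : p ≠ 0 ∨ q ≠ 0) :
    p ^ 2 - q ^ 2 * D ≠ 0 := by
  intro h
  by_cases hq : q = 0
  · subst hq
    simp at h
    simp [h] at hpq
  · have hdvd : q ^ 2 ∣ p ^ 2 := ⟨D, by linear_combination h⟩
    obtain ⟨r, rfl⟩ := (UniqueFactorizationMonoid.pow_dvd_pow_iff_dvd two_ne_zero).1 hdvd
    refine hD ⟨r, mul_left_cancel₀ (pow_ne_zero 2 hq) ?_⟩
    linear_combination -h

section Unit

variable {D u v : K[X]} {δ : K}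

theorem natDegree_left_of_unit {d : ℕ} (hd : 0 < d) (hDd : D.natDegree = 2 * d) (hv : v ≠ 0)
    (hN : u ^ 2 - v ^ 2 * D = C δ) : u.natDegree = v.natDegree + d := by
  have hD0 : D ≠ 0 := by rintro rfl; simp at hDd; omega
  have h1 : (v ^ 2 * D).natDegree = 2 * v.natDegree + 2 * d := by
    rw [natDegree_mul (pow_ne_zero 2 hv) hD0, natDegree_pow, hDd]
  have h2 : (u ^ 2).natDegree = (v ^ 2 * D).natDegree := by
    rw [show u ^ 2 = v ^ 2 * D + C δ by rw [← hN]; ring]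
    exact natDegree_add_C
  rw [natDegree_pow, h1] at h2
  omega

/-- The norm form on the lattice of pairs `(s, q)` with `s ≡ ± q v` modulo `u` only takes values
of large degree. -/
theorem two_mul_natDegree_le_of_dvd {d : ℕ} (h2 : (2 : K) ≠ 0) (hD : ¬ IsSquare D) (hd : 0 < d)
    (hDd : D.natDegree = 2 * d) (hv : v ≠ 0) (hδ : δ ≠ 0) (hN : u ^ 2 - v ^ 2 * D = C δ) :
    ∀ (n : ℕ) (s q : K[X]), q.natDegree = n → (u ∣ s - q * v ∨ u ∣ s + q * v) → (s ≠ 0 ∨ q ≠ 0) →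
      2 * u.natDegree ≤ (s ^ 2 - (q * v) ^ 2 * D).natDegree + d := by
  have hm := natDegree_left_of_unit hd hDd hv hN
  have hu : u ≠ 0 := by rintro rfl; simp at hm; omega
  have hD0 : D ≠ 0 := by rintro rfl; simp at hDd; omega
  have hC2 : (C 2 : K[X]) = 2 := rfl
  intro n
  induction n using Nat.strong_induction_on with
  | _ n ih =>
  intro s q hqn hdvd hsq
  by_cases hq : q = 0
  · subst hq
    have hs : s ≠ 0 := by simpa using hsq
    have hus : u ∣ s := by simpa using hdvd
    have := natDegree_le_of_dvd hus hs
    simp only [zero_mul, ne_eq, OfNat.ofNat_ne_zero, not_false_eq_true, zero_pow, sub_zero,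
      natDegree_pow]
    omega
  wlog hlarge : u.natDegree + q.natDegree ≤ (u * q + s).natDegree generalizing s with H
  · rw [← neg_sq s]
    refine H (-s) ?_ ?_ ?_
    · rcases hdvd with h | h
      · right; rw [← dvd_neg]; convert h using 1; ring
      · left; rw [← dvd_neg]; convert h using 1; ring
    · simpa using hsq
    · by_contra! h
      have h1 : (u * q + s) + (u * q + -s) = C 2 * (u * q) := by rw [hC2]; ring
      have h3 := natDegree_add_le (u * q + s) (u * q + -s)
      rw [h1, natDegree_C_mul h2, natDegree_mul hu hq] at h3
      push Not at hlarge
      have := max_lt hlarge h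
      omega
  by_contra! hlt
  have hqv : q * v ≠ 0 := mul_ne_zero hq hv
  set N := s ^ 2 - (q * v) ^ 2 * D with hNdef
  have hN0 : N ≠ 0 := norm_ne_zero hD (Or.inr hqv)
  set w := u * q - s with hw
  have hfac : w * (u * q + s) = C δ * q ^ 2 - N := by
    rw [hNdef, hw, ← hN]; ring
  have hwdeg : w ≠ 0 →
      w.natDegree + (u.natDegree + q.natDegree) ≤ max (2 * q.natDegree) N.natDegree := by
    intro hw0
    have hne : u * q + s ≠ 0 := by
      intro h
      rw [h, natDegree_zero] at hlarge
      omega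
    have h1 := natDegree_mul hw0 hne
    rw [hfac] at h1
    have h3 := natDegree_sub_le (C δ * q ^ 2) N
    rw [natDegree_C_mul hδ, natDegree_pow] at h3
    omega
  by_cases hcase : 2 * q.natDegree + d < 2 * u.natDegree
  · -- `v / u` would be approximated too well
    obtain ⟨r, e, he, hr⟩ : ∃ r e : K[X], e ^ 2 = 1 ∧ w = u * r - e * (q * v) := by
      rcases hdvd with ⟨r, hr⟩ | ⟨r, hr⟩
      · exact ⟨q - r, 1, by ring, by rw [hw]; linear_combination -hr⟩
      · exact ⟨q - r, -1, by ring, by rw [hw]; linear_combination -hr⟩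
    have hN2 : q ^ 2 - r ^ 2 * D ≠ 0 := norm_ne_zero hD (Or.inl hq)
    have hid : u ^ 2 * (q ^ 2 - r ^ 2 * D) =
        C δ * q ^ 2 - (D * w ^ 2 + C 2 * (D * w * (e * (q * v)))) := by
      rw [← hN, hC2, hr]
      linear_combination (-(q * v) ^ 2 * D) * he
    have hdeg := natDegree_mul (pow_ne_zero 2 hu) hN2
    rw [natDegree_pow, hid] at hdeg
    have h3 := natDegree_sub_le (C δ * q ^ 2) (D * w ^ 2 + C 2 * (D * w * (e * (q * v))))
    rw [natDegree_C_mul hδ, natDegree_pow] at h3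
    by_cases hw0 : w = 0
    · simp only [hw0, ne_eq, OfNat.ofNat_ne_zero, not_false_eq_true, zero_pow, mul_zero, zero_mul,
        add_zero, natDegree_zero, sub_zero] at h3 hdeg
      omega
    · have h4 := natDegree_add_le (D * w ^ 2) (C 2 * (D * w * (e * (q * v))))
      have he1 : e.natDegree = 0 := by
        have := congrArg natDegree he
        rw [natDegree_pow, natDegree_one] at this
        omega
      have he0 : e ≠ 0 := by rintro rfl; simp at he
      rw [natDegree_C_mul h2, natDegree_mul hD0 (pow_ne_zero 2 hw0), natDegree_pow,
        natDegree_mul (mul_ne_zero hD0 hw0) (mul_ne_zero he0 hqv), natDegree_mul hD0 hw0,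
        natDegree_mul he0 hqv, natDegree_mul hq hv] at h4
      have := hwdeg hw0
      omega
  · -- multiply by a unit to lower the degree of `q`
    have hw2 : w.natDegree < q.natDegree := by
      by_cases hw0 : w = 0
      · rw [hw0, natDegree_zero]; omega
      · have := hwdeg hw0
        omega
    set q' := 2 * u * w - C δ * q with hq'
    set s' := s * (2 * u ^ 2 - C δ) - 2 * u * q * (u ^ 2 - C δ) with hs'
    have hqq : q * q' = w ^ 2 - N := by
      rw [hq', hNdef, hw, ← hN]; ring
    have hNN : s' ^ 2 - (q' * v) ^ 2 * D = C (δ ^ 2) * N := by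
      have hv2 : v ^ 2 * D = u ^ 2 - C δ := by rw [← hN]; ring
      rw [hNdef, mul_pow, mul_pow, mul_assoc, mul_assoc, hv2, hs', hq', hw, C_pow]; ring
    have hsq' : s' ≠ 0 ∨ q' ≠ 0 := by
      by_contra! h
      rw [h.1, h.2] at hNN
      have : C (δ ^ 2) * N ≠ 0 := mul_ne_zero (by simpa using hδ) hN0
      exact this (by rw [← hNN]; ring)
    have hdvd' : u ∣ s' - q' * v ∨ u ∣ s' + q' * v := by
      rcases hdvd with ⟨r, hr⟩ | ⟨r, hr⟩
      · left
        refine ⟨s * (2 * u) - 2 * q * (u ^ 2 - C δ) - 2 * w * v - C δ * r, ?_⟩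
        rw [hs', hq']
        linear_combination -C δ * hr
      · right
        refine ⟨s * (2 * u) - 2 * q * (u ^ 2 - C δ) + 2 * w * v - C δ * r, ?_⟩
        rw [hs', hq']
        linear_combination -C δ * hr
    have hlt' : q'.natDegree < n := by
      by_cases hq0 : q' = 0
      · rw [hq0, natDegree_zero]; omega
      · have h1 := natDegree_mul hq hq0
        have h3 := natDegree_sub_le (w ^ 2) N
        rw [hqq] at h1
        rw [natDegree_pow] at h3
        omega
    have := ih _ hlt' s' q' rfl hdvd' hsq'
    rw [hNN, natDegree_C_mul (pow_ne_zero 2 hδ)] at this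
    omega

end Unit

section SquareRoot

variable {D : K[X]} {β : LaurentSeries K}

theorem eq_zero_of_emb_mul_add_emb (hD : ¬ IsSquare D) (hβ : β ^ 2 = emb D) {a b : K[X]}
    (h : emb a * β + emb b = 0) : a = 0 ∧ b = 0 := by
  by_contra hab
  refine norm_ne_zero (p := b) (q := a) hD (by tauto) (emb_injective ?_)
  rw [map_sub, map_mul, map_pow, map_pow, map_zero, ← hβ]
  linear_combination (emb b - emb a * β) * h

theorem irrational_div (hD : ¬ IsSquare D) (hβ : β ^ 2 = emb D) {A B E : K[X]} (hB : B ≠ 0)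
    (hE : E ≠ 0) (a b : K[X]) (h : emb a * ((emb A + emb B * β) / emb E) + emb b = 0) :
    a = 0 ∧ b = 0 := by
  have hE' := emb_ne_zero hE
  field_simp at h
  obtain ⟨h1, h2⟩ := eq_zero_of_emb_mul_add_emb hD hβ (a := a * B) (b := a * A + b * E) (by
    simp only [map_add, map_mul]
    linear_combination h)
  have ha : a = 0 := (mul_eq_zero.1 h1).resolve_right hB
  subst ha
  simpa [hE] using h2

theorem sqrt_ne_zero (hD0 : D ≠ 0) (hβ : β ^ 2 = emb D) : β ≠ 0 := by
  rintro rfl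
  exact emb_ne_zero hD0 (by rw [← hβ]; simp)

theorem order_sqrt {d : ℕ} (hD0 : D ≠ 0) (hDd : D.natDegree = 2 * d) (hβ : β ^ 2 = emb D) :
    β.order = -(d : ℤ) := by
  have h := congrArg HahnSeries.order hβ
  rw [HahnSeries.order_pow, order_emb hD0, hDd] at h
  simp only [nsmul_eq_mul] at h
  push_cast at h
  omega

theorem order_emb_C_two_mul {q : K[X]} (h2 : (2 : K) ≠ 0) (hq : q ≠ 0) :
    emb (C 2 * q) ≠ 0 ∧ (emb (C 2 * q)).order = -(q.natDegree : ℤ) := by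
  have h : C 2 * q ≠ 0 := mul_ne_zero (by simpa using h2) hq
  exact ⟨emb_ne_zero h, by rw [order_emb h, natDegree_C_mul h2]⟩

theorem wellSeparated_of_unit {u v : K[X]} {δ : K} {d : ℕ} (h2 : (2 : K) ≠ 0) (hD : ¬ IsSquare D)
    (hd : 0 < d) (hDd : D.natDegree = 2 * d) (hβ : β ^ 2 = emb D) (hv : v ≠ 0) (hδ : δ ≠ 0)
    (hN : u ^ 2 - v ^ 2 * D = C δ) :
    WellSeparated d ((emb v + emb v * β) / emb u) ((emb v - emb v * β) / emb u) := by
  have hm := natDegree_left_of_unit hd hDd hv hN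
  have hu : u ≠ 0 := by rintro rfl; simp at hm; omega
  have hD0 : D ≠ 0 := by rintro rfl; simp at hDd; omega
  have hu' := emb_ne_zero hu
  have hβ0 := sqrt_ne_zero hD0 hβ
  obtain ⟨hv2, hv2o⟩ := order_emb_C_two_mul h2 hv
  have hdiff : ((emb v + emb v * β) / emb u - (emb v - emb v * β) / emb u) * emb u =
      emb (C 2 * v) * β := by
    rw [map_mul, show (C 2 : K[X]) = 2 from rfl, map_ofNat]
    field_simp
    ring
  have hne : (emb v + emb v * β) / emb u - (emb v - emb v * β) / emb u ≠ 0 := by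
    intro h
    rw [h, zero_mul] at hdiff
    exact mul_ne_zero hv2 hβ0 hdiff.symm
  have hord := congrArg HahnSeries.order hdiff
  rw [HahnSeries.order_mul hne hu', HahnSeries.order_mul hv2 hβ0, hv2o, order_emb hu,
    order_sqrt hD0 hDd hβ] at hord
  refine ⟨hne, by omega, fun p q hpq => ?_⟩
  have hsq : q * v - p * u ≠ 0 ∨ q ≠ 0 := by
    by_cases hq : q = 0
    · left
      simpa [hq, hu] using hpq
    · exact Or.inr hq
  have hbound := two_mul_natDegree_le_of_dvd h2 hD hd hDd hv hδ hN _ (q * v - p * u) q rfl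
    (Or.inl ⟨-p, by ring⟩) hsq
  have hN0 : (q * v - p * u) ^ 2 - (q * v) ^ 2 * D ≠ 0 := by
    apply norm_ne_zero hD
    simpa [hv] using hsq
  have hform : (emb p - emb q * ((emb v + emb v * β) / emb u)) *
      (emb p - emb q * ((emb v - emb v * β) / emb u)) * emb u ^ 2 =
      emb ((q * v - p * u) ^ 2 - (q * v) ^ 2 * D) := by
    simp only [map_sub, map_mul, map_pow, ← hβ]
    field_simp
    ring
  have hne2 : (emb p - emb q * ((emb v + emb v * β) / emb u)) *
      (emb p - emb q * ((emb v - emb v * β) / emb u)) ≠ 0 := by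
    intro h
    rw [h, zero_mul] at hform
    exact emb_ne_zero hN0 hform.symm
  refine ⟨hne2, ?_⟩
  have ho := congrArg HahnSeries.order hform
  rw [HahnSeries.order_mul hne2 (pow_ne_zero 2 hu'), HahnSeries.order_pow, order_emb hu,
    order_emb hN0] at ho
  simp only [nsmul_eq_mul] at ho
  push_cast at ho
  omega

theorem wellSeparated_of_no_unit {d : ℕ} (h2 : (2 : K) ≠ 0) (hD : ¬ IsSquare D)
    (hd : 0 < d) (hDd : D.natDegree = 2 * d) (hβ : β ^ 2 = emb D)
    (hunit : ∀ (u v : K[X]) (δ : K), δ ≠ 0 → u ^ 2 - v ^ 2 * D = C δ → v = 0) (c : K) :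
    WellSeparated d ((emb 0 + emb 1 * β) / emb (X - C c)) (-β / emb (X - C c)) := by
  have hD0 : D ≠ 0 := by rintro rfl; simp at hDd; omega
  have hβ0 := sqrt_ne_zero hD0 hβ
  have hl : X - C c ≠ 0 := X_sub_C_ne_zero c
  have hlo := order_emb hl
  rw [natDegree_X_sub_C] at hlo
  have hldeg : (X - C c).natDegree = 1 := natDegree_X_sub_C c
  set l := X - C c
  have hl' := emb_ne_zero hl
  obtain ⟨h2', h2o⟩ := order_emb_C_two_mul h2 (one_ne_zero (α := K[X]))
  have hdiff : ((emb 0 + emb 1 * β) / emb l - -β / emb l) * emb l = emb (C 2 * 1) * β := by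
    rw [map_mul, show (C 2 : K[X]) = 2 from rfl, map_ofNat, map_zero, map_one]
    field_simp
    ring
  have hne : (emb 0 + emb 1 * β) / emb l - -β / emb l ≠ 0 := by
    intro h
    rw [h, zero_mul] at hdiff
    exact mul_ne_zero h2' hβ0 hdiff.symm
  have hord := congrArg HahnSeries.order hdiff
  rw [HahnSeries.order_mul hne hl', HahnSeries.order_mul h2' hβ0, h2o, natDegree_one, hlo,
    order_sqrt hD0 hDd hβ] at hord
  refine ⟨hne, by omega, fun p q hpq => ?_⟩
  have hN0 : (p * l) ^ 2 - q ^ 2 * D ≠ 0 := by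
    apply norm_ne_zero hD
    simpa [hl] using hpq
  have hN1 : 1 ≤ ((p * l) ^ 2 - q ^ 2 * D).natDegree := by
    by_contra! h
    have hC := eq_C_of_natDegree_eq_zero (Nat.lt_one_iff.1 h)
    have hq := hunit (p * l) q _ (fun h0 => hN0 (by rw [hC, h0, C_0])) hC
    subst hq
    have hp : p ≠ 0 := by simpa using hpq
    rw [zero_pow two_ne_zero, zero_mul, sub_zero, natDegree_pow, natDegree_mul hp hl, hldeg] at h
    omega
  have hform : (emb p - emb q * ((emb 0 + emb 1 * β) / emb l)) * (emb p - emb q * (-β / emb l)) *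
      emb l ^ 2 = emb ((p * l) ^ 2 - q ^ 2 * D) := by
    simp only [map_sub, map_mul, map_pow, ← hβ, map_zero, map_one]
    field_simp
    ring
  have hne2 : (emb p - emb q * ((emb 0 + emb 1 * β) / emb l)) *
      (emb p - emb q * (-β / emb l)) ≠ 0 := by
    intro h
    rw [h, zero_mul] at hform
    exact emb_ne_zero hN0 hform.symm
  refine ⟨hne2, ?_⟩
  have ho := congrArg HahnSeries.order hform
  rw [HahnSeries.order_mul hne2 (pow_ne_zero 2 hl'), HahnSeries.order_pow, hlo,
    order_emb hN0] at ho
  simp only [nsmul_eq_mul] at ho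
  push_cast at ho
  omega

theorem exists_approx [Finite K] (β : LaurentSeries K) (n : ℕ) :
    ∃ p q : K[X], q ≠ 0 ∧ q.natDegree ≤ n ∧
      (emb p - emb q * β ≠ 0 → (n : ℤ) < (emb p - emb q * β).order) := by
  have := Fintype.ofFinite K
  obtain ⟨c, c', hne, heq⟩ := Fintype.exists_ne_map_eq_of_card_lt
    (fun (c : Fin (n + 1) → K) (i : Fin n) =>
      (emb ((degreeLTEquiv K (n + 1)).symm c : K[X]) * β).coeff ((i : ℤ) + 1))
    (by
      classical
      rw [Fintype.card_fun, Fintype.card_fun, Fintype.card_fin, Fintype.card_fin]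
      exact Nat.pow_lt_pow_right Fintype.one_lt_card (Nat.lt_succ_self n))
  set q := (degreeLTEquiv K (n + 1)).symm (c - c') with hq
  have hqne : q ≠ 0 := by
    rw [hq, Ne, LinearEquiv.map_eq_zero_iff, sub_eq_zero]
    exact hne
  refine ⟨polyPart (emb (q : K[X]) * β), q, by simpa using hqne, ?_, fun h => ?_⟩
  · have := mem_degreeLT.1 q.2
    rw [← Nat.lt_succ_iff]
    exact (natDegree_lt_iff_degree_lt (by simpa using hqne)).2 this
  · rw [← HahnSeries.order_neg, neg_sub]
    rw [← neg_ne_zero, neg_sub] at h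
    rw [← Int.add_one_le_iff, HahnSeries.le_order_iff_forall h]
    intro j hj
    by_cases hj0 : j ≤ 0
    · exact coeff_sub_polyPart _ hj0
    · rw [HahnSeries.coeff_sub, coeff_emb, if_neg hj0, sub_zero, hq, map_sub,
        Submodule.coe_sub, map_sub, sub_mul, HahnSeries.coeff_sub, sub_eq_zero]
      have := congrFun heq ⟨(j - 1).toNat, by omega⟩
      simp only at this
      rwa [show (((j - 1).toNat : ℕ) : ℤ) + 1 = j by omega] at this

theorem exists_unit_of_finite [Finite K] {d : ℕ} (h2 : (2 : K) ≠ 0) (hD : ¬ IsSquare D)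
    (hd : 0 < d) (hDd : D.natDegree = 2 * d) (hβ : β ^ 2 = emb D) :
    ∃ u v : K[X], v ≠ 0 ∧ u ^ 2 - v ^ 2 * D = 1 := by
  have hD0 : D ≠ 0 := by rintro rfl; simp at hDd; omega
  have hβ0 := sqrt_ne_zero hD0 hβ
  have hβo := order_sqrt hD0 hDd hβ
  choose P Q hQ hQn hPQ using exists_approx β
  have hminus (n : ℕ) : emb (P n) - emb (Q n) * β ≠ 0 := fun h =>
    hQ n (neg_eq_zero.1 (eq_zero_of_emb_mul_add_emb hD hβ (a := -Q n) (b := P n)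
      (by rw [map_neg]; linear_combination h)).1)
  have hplus (n : ℕ) : emb (P n) + emb (Q n) * β ≠ 0 := fun h =>
    hQ n (eq_zero_of_emb_mul_add_emb hD hβ (a := Q n) (b := P n) (by linear_combination h)).1
  set N : ℕ → K[X] := fun n => P n ^ 2 - Q n ^ 2 * D with hNdef
  have hN0 (n : ℕ) : N n ≠ 0 := norm_ne_zero hD (Or.inr (hQ n))
  have hNfac (n : ℕ) :
      (emb (P n) - emb (Q n) * β) * (emb (P n) + emb (Q n) * β) = emb (N n) := by
    simp only [hNdef, map_sub, map_mul, map_pow, ← hβ]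
    ring
  have hNd (n : ℕ) : (N n).degree < d := by
    have h1 := congrArg HahnSeries.order (hNfac n)
    rw [HahnSeries.order_mul (hminus n) (hplus n), order_emb (hN0 n)] at h1
    obtain ⟨hq2, hq2o⟩ := order_emb_C_two_mul h2 (hQ n)
    have hsum : (emb (P n) - emb (Q n) * β) + emb (C 2 * Q n) * β =
        emb (P n) + emb (Q n) * β := by
      rw [map_mul, show (C 2 : K[X]) = 2 from rfl, map_ofNat]
      ring
    have h3 := HahnSeries.min_order_le_order_add (x := emb (P n) - emb (Q n) * β)
      (y := emb (C 2 * Q n) * β) (by rw [hsum]; exact hplus n)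
    rw [hsum, HahnSeries.order_mul hq2 hβ0, hq2o, hβo] at h3
    have h4 := hPQ n (hminus n)
    have h5 := hQn n
    rw [degree_eq_natDegree (hN0 n), Nat.cast_lt]
    omega
  have hmod (n : ℕ) (p : K[X]) : (p % N n).degree < d := (degree_mod_lt p (hN0 n)).trans (hNd n)
  obtain ⟨y, hy⟩ := Finite.exists_infinite_fiber (fun n : ℕ =>
    ((fun i : Fin d => (N n).coeff i), (fun i : Fin d => (P n % N n).coeff i),
      (fun i : Fin d => (Q n % N n).coeff i)))
  rw [Set.infinite_coe_iff] at hy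
  obtain ⟨m, hm⟩ := hy.nonempty
  obtain ⟨k, hk, hkm⟩ := hy.exists_gt (emb (P m) - emb (Q m) * β).order.toNat
  have hkm' : (emb (P m) - emb (Q m) * β).order < (emb (P k) - emb (Q k) * β).order := by
    have := hPQ k (hminus k)
    omega
  have heq := hm.trans hk.symm
  simp only [Prod.mk.injEq] at heq
  obtain ⟨e1, e2, e3⟩ := heq
  have hext {p q : K[X]} (hp : p.degree < d) (hq : q.degree < d)
      (h : (fun i : Fin d => p.coeff i) = fun i : Fin d => q.coeff i) : p = q := by
    ext i
    by_cases hi : i < d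
    · exact congrFun h ⟨i, hi⟩
    · have hi' : (d : WithBot ℕ) ≤ i := by exact_mod_cast not_lt.1 hi
      rw [coeff_eq_zero_of_degree_lt (hp.trans_le hi'),
        coeff_eq_zero_of_degree_lt (hq.trans_le hi')]
  have f1 : N m = N k := hext (hNd m) (hNd k) e1
  have f2 := hext (hmod m _) (hmod k _) e2
  have f3 := hext (hmod m _) (hmod k _) e3
  rw [← f1] at f2 f3
  obtain ⟨a, ha⟩ : N m ∣ P k - P m := (EuclideanDomain.mod_eq_zero).1 (by
    rw [sub_mod, f2, sub_self])
  obtain ⟨b, hb⟩ : N m ∣ Q k - Q m := (EuclideanDomain.mod_eq_zero).1 (by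
    rw [sub_mod, f3, sub_self])
  have hPk : P k = P m + N m * a := by rw [← ha]; ring
  have hQk : Q k = Q m + N m * b := by rw [← hb]; ring
  have hNm : N m = P m ^ 2 - Q m ^ 2 * D := rfl
  have hNk : N m = P k ^ 2 - Q k ^ 2 * D := f1
  have hu : P m * P k - Q m * Q k * D = N m * (1 + P m * a - Q m * b * D) := by
    rw [hPk, hQk]
    linear_combination -hNm
  have hv : Q m * P k - P m * Q k = N m * (Q m * a - P m * b) := by
    rw [hPk, hQk]
    ring
  have hpell : (1 + P m * a - Q m * b * D) ^ 2 - (Q m * a - P m * b) ^ 2 * D = 1 := by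
    apply mul_left_cancel₀ (pow_ne_zero 2 (hN0 m))
    have : (N m * (1 + P m * a - Q m * b * D)) ^ 2 - (N m * (Q m * a - P m * b)) ^ 2 * D =
        N m * N m := by
      nth_rewrite 3 [hNm]
      rw [← hu, ← hv, hNk]
      ring
    linear_combination this
  refine ⟨1 + P m * a - Q m * b * D, Q m * a - P m * b, fun hv0 => ?_, hpell⟩
  rw [hv0] at hpell hv
  have hu1 : (1 + P m * a - Q m * b * D) ^ 2 = 1 := by linear_combination hpell
  have hprod : (emb (P m) - emb (Q m) * β) * (emb (P k) + emb (Q k) * β) =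
      emb (1 + P m * a - Q m * b * D) *
        ((emb (P k) - emb (Q k) * β) * (emb (P k) + emb (Q k) * β)) := by
    rw [hNfac, ← f1, ← map_mul, mul_comm _ (N m), ← hu]
    have := congrArg emb hv
    simp only [map_sub, map_mul, map_zero, ← hβ] at this ⊢
    linear_combination -β * this
  have hcancel := mul_right_cancel₀ (hplus k) (hprod.trans (mul_assoc _ _ _).symm)
  rcases sq_eq_one_iff.1 hu1 with h | h
  · rw [h, map_one, one_mul] at hcancel
    rw [hcancel] at hkm'
    exact lt_irrefl _ hkm'
  · rw [h, map_neg, map_one, neg_one_mul] at hcancel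
    rw [hcancel, HahnSeries.order_neg] at hkm'
    exact lt_irrefl _ hkm'

end SquareRoot

section Families

variable {D : K[X]} {β : LaurentSeries K}

theorem exists_units_of_unit {d : ℕ} (h2 : (2 : K) ≠ 0) (hd : 0 < d) (hDd : D.natDegree = 2 * d)
    {u v : K[X]} {δ : K} (hv : v ≠ 0) (hδ : δ ≠ 0) (hN : u ^ 2 - v ^ 2 * D = C δ) (n : ℕ) :
    ∃ (u' v' : K[X]) (δ' : K), v' ≠ 0 ∧ δ' ≠ 0 ∧ u' ^ 2 - v' ^ 2 * D = C δ' ∧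
      u'.natDegree = 2 ^ n * u.natDegree := by
  induction n with
  | zero => exact ⟨u, v, δ, hv, hδ, hN, by simp⟩
  | succ n ih =>
    obtain ⟨a, b, ε, hb, hε, hab, hdeg⟩ := ih
    have hm := natDegree_left_of_unit hd hDd hb hab
    have ha : a ≠ 0 := by rintro rfl; simp at hm; omega
    have h2C : (C 2 : K[X]) ≠ 0 := by simpa using h2
    have hC2 : (C 2 : K[X]) = 2 := rfl
    refine ⟨C 2 * a ^ 2 - C ε, C 2 * a * b, ε ^ 2, mul_ne_zero (mul_ne_zero h2C ha) hb,
      pow_ne_zero 2 hε, ?_, ?_⟩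
    · rw [C_pow, ← hab, hC2]
      ring
    · rw [natDegree_sub_C, natDegree_C_mul h2, natDegree_pow, hdeg]
      ring

/-- Equivalence of the series attached to two units bounds the ratio of the units. -/
theorem MEquiv.natDegree_le_of_unit {d : ℕ} (h2 : (2 : K) ≠ 0) (hD : ¬ IsSquare D) (hd : 0 < d)
    (hDd : D.natDegree = 2 * d) (hβ : β ^ 2 = emb D) {u v u' v' : K[X]} {δ δ' : K}
    (hv : v ≠ 0) (hδ : δ ≠ 0) (hN : u ^ 2 - v ^ 2 * D = C δ)
    (hv' : v' ≠ 0) (hN' : u' ^ 2 - v' ^ 2 * D = C δ')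
    (h : MEquiv ((emb v + emb v * β) / emb u) ((emb v' + emb v' * β) / emb u')) :
    u.natDegree ≤ u'.natDegree + d := by
  have hD0 : D ≠ 0 := by rintro rfl; simp at hDd; omega
  have hm := natDegree_left_of_unit hd hDd hv hN
  have hm' := natDegree_left_of_unit hd hDd hv' hN'
  have hu : u ≠ 0 := by rintro rfl; simp at hm; omega
  have hu' : u' ≠ 0 := by rintro rfl; simp at hm'; omega
  have h4 : (4 : K) ≠ 0 := by
    rw [show (4 : K) = 2 * 2 by norm_num]
    exact mul_ne_zero h2 h2
  have root {u v : K[X]} {δ : K} (hu : u ≠ 0) (hN : u ^ 2 - v ^ 2 * D = C δ) :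
      emb (u ^ 2) * ((emb v + emb v * β) / emb u) ^ 2 +
        emb (-2 * u * v) * ((emb v + emb v * β) / emb u) + emb (v ^ 2 - u ^ 2 + C δ) = 0 := by
    have hu' := emb_ne_zero hu
    rw [← hN]
    simp only [map_add, map_sub, map_mul, map_pow, map_neg, map_ofNat, ← hβ]
    field_simp
    ring
  have disc {u v : K[X]} {δ : K} (hN : u ^ 2 - v ^ 2 * D = C δ) :
      (-2 * u * v) ^ 2 - 4 * u ^ 2 * (v ^ 2 - u ^ 2 + C δ) = C 4 * (u ^ 2 * (v ^ 2 * D)) := by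
    rw [← hN, show (C 4 : K[X]) = 4 from rfl]
    ring
  have disc_deg {u v : K[X]} (hu : u ≠ 0) (hv : v ≠ 0) :
      C 4 * (u ^ 2 * (v ^ 2 * D)) ≠ 0 ∧
      (C 4 * (u ^ 2 * (v ^ 2 * D))).natDegree = 2 * u.natDegree + (2 * v.natDegree + 2 * d) := by
    have h1 := mul_ne_zero (pow_ne_zero 2 hv) hD0
    refine ⟨mul_ne_zero (by simpa using h4) (mul_ne_zero (pow_ne_zero 2 hu) h1), ?_⟩
    rw [natDegree_C_mul h4, natDegree_mul (pow_ne_zero 2 hu) h1,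
      natDegree_mul (pow_ne_zero 2 hv) hD0, natDegree_pow, natDegree_pow, hDd]
  obtain ⟨R, e, he, heq⟩ := h.discrim (irrational_div hD hβ hv hu) (pow_ne_zero 2 hu)
    (root hu hN) (root hu' hN') (κ := C δ * (D - C 1)) (r := D - 1) (s := 0) (t := D) (by
      rw [← hN, C_1]
      ring)
  rw [disc hN, disc hN'] at heq
  obtain ⟨hne, hdeg⟩ := disc_deg hu hv
  obtain ⟨hne', hdeg'⟩ := disc_deg hu' hv'
  have hD1 : (D - C 1).natDegree = 2 * d := by rw [natDegree_sub_C, hDd]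
  have hD1' : D - C 1 ≠ 0 := by
    intro h
    rw [h, natDegree_zero] at hD1
    omega
  have hκ : C δ * (D - C 1) ≠ 0 := mul_ne_zero (by simpa using hδ) hD1'
  have hl := mul_ne_zero (pow_ne_zero 2 hκ) (pow_ne_zero 2 he.ne_zero)
  have hR : R ^ 2 ≠ 0 := by
    intro h
    rw [h, zero_mul] at heq
    exact mul_ne_zero hl hne' heq
  have := congrArg natDegree heq
  rw [natDegree_mul hl hne', natDegree_mul (pow_ne_zero 2 hκ) (pow_ne_zero 2 he.ne_zero),
    natDegree_pow, natDegree_pow, natDegree_eq_zero_of_isUnit he, natDegree_C_mul hδ, hD1,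
    natDegree_mul hR hne, hdeg, hdeg'] at this
  omega

theorem MEquiv.eq_of_sub_C (h2 : (2 : K) ≠ 0) (hD : ¬ IsSquare D)
    (hβ : β ^ 2 = emb D) {a b : K} (ha : D.eval a ≠ 0)
    (h : MEquiv ((emb 0 + emb 1 * β) / emb (X - C a)) ((emb 0 + emb 1 * β) / emb (X - C b))) :
    a = b := by
  have h4 : (4 : K) ≠ 0 := by
    rw [show (4 : K) = 2 * 2 by norm_num]
    exact mul_ne_zero h2 h2
  have root (c : K) : emb ((X - C c) ^ 2) * ((emb 0 + emb 1 * β) / emb (X - C c)) ^ 2 +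
      emb 0 * ((emb 0 + emb 1 * β) / emb (X - C c)) + emb (-D) = 0 := by
    have := emb_ne_zero (X_sub_C_ne_zero c)
    rw [map_neg, ← hβ, map_pow, map_zero, map_one]
    field_simp
    ring
  have hcop : IsCoprime ((X - C a) ^ 2) D :=
    (((irreducible_X_sub_C a).coprime_iff_not_dvd).2
      (fun hdvd => ha (dvd_iff_isRoot.1 hdvd))).pow_left
  obtain ⟨r, t, hrt⟩ := hcop
  obtain ⟨R, e, he, heq⟩ := h.discrim
    (irrational_div hD hβ one_ne_zero (X_sub_C_ne_zero a)) (pow_ne_zero 2 (X_sub_C_ne_zero a))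
    (root a) (root b) (κ := 1) (r := r) (s := 0) (t := -t) (by rw [← hrt]; ring)
  have hev := congrArg (eval a) heq
  have hea : eval a e ≠ 0 := (he.map (evalRingHom a)).ne_zero
  simp only [eval_mul, eval_pow, eval_sub, eval_neg, eval_X, eval_C, eval_one, eval_ofNat,
    eval_zero] at hev
  have : (4 * eval a D * eval a e ^ 2) * (a - b) ^ 2 = 0 := by linear_combination hev
  have h0 := (mul_eq_zero.1 this).resolve_left
    (mul_ne_zero (mul_ne_zero h4 ha) (pow_ne_zero 2 hea))
  exact sub_eq_zero.1 (pow_eq_zero_iff two_ne_zero |>.1 h0)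

end Families

end PaperCF

open PaperCF in
/-- For every field `K` of characteristic `≠ 2` and every `D ∈ S_K`
of degree `2d`, there exist infinitely many pairwise non-equivalent quadratic
irrationalities `α = (A + B√D)/C ∈ K(T, √D) \ K(T)` (with `B, C ≠ 0`) such that
`K(α) ≤ d`. -/
theorem mcmullen_bound_d {K : Type*} [Field K]
    (hchar : ringChar K ≠ 2) (D : Polynomial K)
    (hDeven : Even D.natDegree) (hDpos : 0 < D.natDegree)
    (hDnsq : ¬ IsSquare D) (hDlead : IsSquare D.leadingCoeff)
    (β : LaurentSeries K) (hβ : β ^ 2 = emb D) :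
    ∃ f : ℕ → LaurentSeries K,
      (∀ i : ℕ, ∃ A B C : Polynomial K, B ≠ 0 ∧ C ≠ 0 ∧
        f i = (emb A + emb B * β) / emb C) ∧
      (∀ i j : ℕ, i ≠ j → ¬ MEquiv (f i) (f j)) ∧
      (∀ i : ℕ, KK (f i) ≤ ((D.natDegree / 2 : ℕ) : ℕ∞)) := by
  obtain ⟨d, hDd⟩ : ∃ d, D.natDegree = 2 * d := even_iff_two_dvd.1 hDeven
  have hd : 0 < d := by omega
  have hdiv : D.natDegree / 2 = d := by omega
  have h2 : (2 : K) ≠ 0 := Ring.two_ne_zero hchar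
  have hD0 : D ≠ 0 := by rintro rfl; simp at hDpos
  rw [hdiv]
  by_cases hunit : ∀ (u v : Polynomial K) (δ : K), δ ≠ 0 → u ^ 2 - v ^ 2 * D = Polynomial.C δ → v = 0
  · have hinf : Infinite K := by
      by_contra hfin
      have := not_infinite_iff_finite.1 hfin
      obtain ⟨u, v, hv, huv⟩ := exists_unit_of_finite h2 hDnsq hd hDd hβ
      exact hv (hunit u v 1 one_ne_zero (by rw [huv, Polynomial.C_1]))
    have hS : {c : K | D.IsRoot c}ᶜ.Infinite := (Polynomial.finite_setOfPred_isRoot hD0).infinite_compl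
    set c := hS.natEmbedding
    refine ⟨fun i => (emb 0 + emb 1 * β) / emb (Polynomial.X - Polynomial.C (c i : K)),
      fun i => ⟨0, 1, Polynomial.X - Polynomial.C (c i : K), one_ne_zero, Polynomial.X_sub_C_ne_zero _, rfl⟩,
      fun i j hij h => ?_, fun i =>
        (wellSeparated_of_no_unit h2 hDnsq hd hDd hβ hunit (c i : K)).KK_le⟩
    exact hij (c.injective (Subtype.ext (h.eq_of_sub_C h2 hDnsq hβ (c i).2)))
  · push Not at hunit
    obtain ⟨u, v, δ, hδ, hN, hv⟩ := hunit
    have hm := natDegree_left_of_unit hd hDd hv hN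
    choose U V Δ hV hΔ hUV hU using
      fun i : ℕ => exists_units_of_unit h2 hd hDd hv hδ hN (i + 1)
    have hU0 (i : ℕ) : U i ≠ 0 := by
      intro h
      have := natDegree_left_of_unit hd hDd (hV i) (hUV i)
      rw [h, Polynomial.natDegree_zero] at this
      omega
    have hlt {i j : ℕ} (hij : j < i) : (U j).natDegree + d < (U i).natDegree := by
      rw [hU, hU]
      have h1 : 2 * 2 ^ (j + 1) ≤ 2 ^ (i + 1) := by
        rw [← pow_succ']
        exact Nat.pow_le_pow_right two_pos (by omega)
      have h3 : 2 ≤ 2 ^ (j + 1) := Nat.le_self_pow (by omega) 2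
      nlinarith [Nat.mul_le_mul_right u.natDegree h1, Nat.mul_le_mul_right u.natDegree h3]
    have key {i j : ℕ} (hij : j < i) :
        ¬ MEquiv ((emb (V i) + emb (V i) * β) / emb (U i))
          ((emb (V j) + emb (V j) * β) / emb (U j)) := fun h =>
      (hlt hij).not_ge
        (h.natDegree_le_of_unit h2 hDnsq hd hDd hβ (hV i) (hΔ i) (hUV i) (hV j) (hUV j))
    refine ⟨fun i => (emb (V i) + emb (V i) * β) / emb (U i),
      fun i => ⟨V i, V i, U i, hV i, hU0 i, rfl⟩, fun i j hij h => ?_, fun i =>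
        (wellSeparated_of_unit h2 hDnsq hd hDd hβ (hV i) (hΔ i) (hUV i)).KK_le⟩
    rcases lt_or_gt_of_ne hij with h' | h'
    · exact key h' h.symm
    · exact key h' h
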